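/- Let r : ℝ → ℂ be continuously differentiable with derivative r' ∈ L²(ℝ). Let t > 0, k₀ ≥ 0 and set z₀ = (20t)^{1/5} k₀. On the open sector S = { z₀ + ρ e^{iφ} : ρ > 0, 0 < φ < π/6 } define R₁(z) = −r(k₀) + ( r(k₀) − r( (20t)^{−1/5} Re z ) ) · cos( 3 arg(z − z₀) ). Then R₁ is real-differentiable on S, its continuous boundary values equal −r((20t)^{−1/5} x) for real x > z₀ (φ → 0) and equal −r(k₀) on the ray arg(z − z₀) = π/6, and its Dbar derivative satisfies, for every z ∈ S, |∂̄R₁(z)| ≤ (1/2) (20t)^{−1/5} | r'( (20t)^{−1/5} Re z ) | + (3/2) ‖r'‖_{L²(ℝ)} (20t)^{−1/10} |z − z₀|^{−1/2}. -/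

import Mathlib

open MeasureTheory

/-- The Dbar (Cauchy–Riemann) operator `∂̄F = (1/2)(∂F/∂x + i ∂F/∂y)` of a function of the
complex variable `z = x + iy`, computed via real partial derivatives. -/
noncomputable def dbar (F : ℂ → ℂ) (z : ℂ) : ℂ :=
  (1 / 2) * (deriv (fun x : ℝ => F (z + (x : ℂ))) 0
    + Complex.I * deriv (fun y : ℝ => F (z + (y : ℂ) * Complex.I)) 0)

/-- The non-analytic extension
`R₁(z) = −r(k₀) + (r(k₀) − r((20t)^{−1/5} Re z)) · cos(3 arg(z − z₀))`
of the rescaled reflection coefficient, where `z₀ = (20t)^{1/5} k₀`. -/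
noncomputable def R1ext (r : ℝ → ℂ) (t k₀ : ℝ) (z : ℂ) : ℂ :=
  -r k₀ + (r k₀ - r ((20 * t) ^ (-(1 : ℝ) / 5) * z.re)) *
    ((Real.cos (3 * Complex.arg (z - (((20 * t) ^ ((1 : ℝ) / 5) * k₀ : ℝ) : ℂ)))) : ℂ)


lemma holder_half (r : ℝ → ℂ) (hr : ContDiff ℝ 1 r)
    (hr' : MemLp (deriv r) 2 volume) (a b : ℝ) :
    ‖r b - r a‖ ≤ (eLpNorm (deriv r) 2 volume).toReal * |b - a| ^ ((1 : ℝ) / 2) := by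
  have hc : Continuous (deriv r) := hr.continuous_deriv le_rfl
  have h1 : ∫ x in a..b, deriv r x = r b - r a :=
    intervalIntegral.integral_deriv_eq_sub
      (fun x _ => (hr.differentiable one_ne_zero).differentiableAt)
      (hc.intervalIntegrable _ _)
  rw [← h1]
  have hint : IntegrableOn (deriv r) (Set.uIoc a b) volume :=
    intervalIntegrable_iff.mp (hc.intervalIntegrable a b)
  refine (intervalIntegral.norm_integral_le_integral_norm_uIoc).trans ?_
  have h2 : ∫ x in Set.uIoc a b, ‖deriv r x‖
      = (eLpNorm (deriv r) 1 (volume.restrict (Set.uIoc a b))).toReal := by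
    rw [integral_norm_eq_lintegral_enorm hint.1, eLpNorm_one_eq_lintegral_enorm]
  rw [h2]
  have h3 := eLpNorm_le_eLpNorm_mul_rpow_measure_univ (p := 1) (q := 2)
    (μ := volume.restrict (Set.uIoc a b)) (f := deriv r) (by norm_num)
    hc.aestronglyMeasurable
  have h4 : eLpNorm (deriv r) 2 (volume.restrict (Set.uIoc a b)) ≤ eLpNorm (deriv r) 2 volume :=
    eLpNorm_mono_measure _ Measure.restrict_le_self
  have h5 : (volume.restrict (Set.uIoc a b)) Set.univ = ENNReal.ofReal |b - a| := by
    rw [Measure.restrict_apply_univ, Real.volume_uIoc]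
  rw [h5] at h3
  have h6 := h3.trans (mul_le_mul_left h4 _)
  have hfin := hr'.2.ne
  have h7 := ENNReal.toReal_mono (ENNReal.mul_ne_top hfin
    (ENNReal.rpow_ne_top_of_nonneg (by norm_num) ENNReal.ofReal_ne_top)) h6
  refine h7.trans (le_of_eq ?_)
  rw [ENNReal.toReal_mul, ← ENNReal.toReal_rpow, ENNReal.toReal_ofReal (abs_nonneg _)]
  norm_num

lemma R1ext_line (r : ℝ → ℂ) (hr : ContDiff ℝ 1 r) (t k₀ : ℝ) (z v : ℂ) (w : ℂ)
    (hw : w = z - (((20 * t) ^ ((1 : ℝ) / 5) * k₀ : ℝ) : ℂ)) (hs : w ∈ Complex.slitPlane) :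
    HasDerivAt (fun s : ℝ => R1ext r t k₀ (z + (s : ℂ) * v))
      (-(((((20 * t) ^ (-(1 : ℝ) / 5) * v.re : ℝ) : ℂ)) *
          deriv r ((20 * t) ^ (-(1 : ℝ) / 5) * z.re)) * (Real.cos (3 * w.arg) : ℂ)
        + (r k₀ - r ((20 * t) ^ (-(1 : ℝ) / 5) * z.re)) *
          ((-Real.sin (3 * w.arg) * (3 * (v / w).im) : ℝ) : ℂ)) 0 := by
  set c : ℝ := (20 * t) ^ (-(1 : ℝ) / 5) with hc
  have hlin : HasDerivAt (fun s : ℝ => w + (s : ℂ) * v) v 0 := by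
    have := (((Complex.ofRealCLM.hasDerivAt (x := (0:ℝ))).mul_const v).const_add w)
    simpa using this
  have hlog : HasDerivAt (fun s : ℝ => Complex.log (w + (s : ℂ) * v)) (v / w) 0 := by
    have := hlin.clog_real (by simpa using hs)
    simpa using this
  have harg : HasDerivAt (fun s : ℝ => Complex.arg (w + (s : ℂ) * v)) (v / w).im 0 := by
    have := (Complex.imCLM.hasFDerivAt (x := Complex.log (w + ((0:ℝ) : ℂ) * v))).comp_hasDerivAt
      (0:ℝ) hlog
    simpa [Function.comp_def, Complex.log_im] using this
  have hcos : HasDerivAt (fun s : ℝ => ((Real.cos (3 * Complex.arg (w + (s : ℂ) * v)) : ℝ) : ℂ))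
      ((-Real.sin (3 * w.arg) * (3 * (v / w).im) : ℝ) : ℂ) 0 := by
    have := ((harg.const_mul 3).cos).ofReal_comp
    simpa using this
  have hre : HasDerivAt (fun s : ℝ => c * (z.re + s * v.re)) (c * v.re) 0 := by
    have := (((hasDerivAt_id (0:ℝ)).mul_const v.re).const_add z.re).const_mul c
    simpa using this
  have hrr : HasDerivAt (fun s : ℝ => r (c * (z.re + s * v.re)))
      (((c * v.re : ℝ) : ℂ) * deriv r (c * z.re)) 0 := by
    have h0 : HasDerivAt r (deriv r (c * z.re)) (c * (z.re + 0 * v.re)) := by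
      have := ((hr.differentiable one_ne_zero).differentiableAt (x := c * z.re)).hasDerivAt
      simpa using this
    have := h0.scomp (0:ℝ) hre
    simpa [Function.comp_def] using this
  have := ((hrr.const_sub (r k₀)).mul hcos).const_add (-r k₀)
  have hf : (fun s : ℝ => R1ext r t k₀ (z + (s : ℂ) * v)) = fun s : ℝ => -r k₀ +
      ((fun s : ℝ => r k₀ - r (c * (z.re + s * v.re))) *
        fun s : ℝ => ((Real.cos (3 * Complex.arg (w + (s : ℂ) * v)) : ℝ) : ℂ)) s := by
    funext s
    simp only [R1ext, Pi.mul_apply]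
    rw [← hc, hw]
    simp only [Complex.add_re, Complex.re_ofReal_mul]
    rw [sub_add_eq_add_sub]
  rw [hf]
  refine this.congr_deriv ?_
  simp only [Complex.ofReal_zero, zero_mul, add_zero]

lemma R1ext_diff (r : ℝ → ℂ) (hr : ContDiff ℝ 1 r) (t k₀ : ℝ) (z : ℂ)
    (hs : z - (((20 * t) ^ ((1 : ℝ) / 5) * k₀ : ℝ) : ℂ) ∈ Complex.slitPlane) :
    DifferentiableAt ℝ (R1ext r t k₀) z := by
  have hlog : DifferentiableAt ℝ
      (fun z : ℂ => Complex.log (z - (((20 * t) ^ ((1 : ℝ) / 5) * k₀ : ℝ) : ℂ))) z :=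
    DifferentiableAt.restrictScalars ℝ
      (DifferentiableAt.clog (differentiableAt_id.sub_const _) hs)
  have harg : DifferentiableAt ℝ
      (fun z : ℂ => Complex.arg (z - (((20 * t) ^ ((1 : ℝ) / 5) * k₀ : ℝ) : ℂ))) z := by
    have := Complex.imCLM.differentiableAt.comp z hlog
    simpa [Function.comp_def, Complex.log_im] using this
  have hcos : DifferentiableAt ℝ (fun z : ℂ =>
      ((Real.cos (3 * Complex.arg (z - (((20 * t) ^ ((1 : ℝ) / 5) * k₀ : ℝ) : ℂ))) : ℝ) : ℂ)) z :=
    Complex.ofRealCLM.differentiableAt.comp z ((harg.const_mul 3).cos)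
  have hrr : DifferentiableAt ℝ (fun z : ℂ => r ((20 * t) ^ (-(1 : ℝ) / 5) * z.re)) z :=
    ((hr.differentiable one_ne_zero).differentiableAt).comp z
      (Complex.reCLM.differentiableAt.const_mul _)
  exact ((hrr.const_sub _).mul hcos).const_add _

lemma R1ext_dbar_bound (r : ℝ → ℂ) (hr : ContDiff ℝ 1 r) (t k₀ : ℝ) (ht : 0 < t) (z : ℂ) (w : ℂ)
    (hw : w = z - (((20 * t) ^ ((1 : ℝ) / 5) * k₀ : ℝ) : ℂ)) (hs : w ∈ Complex.slitPlane) :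
    ‖dbar (R1ext r t k₀) z‖ ≤ (1 / 2) * (20 * t) ^ (-(1 : ℝ) / 5)
            * ‖deriv r ((20 * t) ^ (-(1 : ℝ) / 5) * z.re)‖
          + (3 / 2) * ‖r k₀ - r ((20 * t) ^ (-(1 : ℝ) / 5) * z.re)‖ * ‖w‖⁻¹ := by
  have hx := (R1ext_line r hr t k₀ z 1 w hw hs).deriv
  have hy := (R1ext_line r hr t k₀ z Complex.I w hw hs).deriv
  simp only [mul_one] at hx
  have hc0 : 0 ≤ (20 * t) ^ (-(1 : ℝ) / 5) := by positivity
  set c : ℝ := (20 * t) ^ (-(1 : ℝ) / 5) with hc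
  set g := r k₀ - r (c * z.re)
  have hconj : (((1 / w).im : ℝ) : ℂ) + Complex.I * (((Complex.I / w).im : ℝ) : ℂ)
      = Complex.I * (starRingEnd ℂ) w⁻¹ := by
    rw [div_eq_mul_inv, div_eq_mul_inv]
    apply Complex.ext <;> simp [neg_div]
  have key : dbar (R1ext r t k₀) z = -((1 / 2) * (c : ℂ) * deriv r (c * z.re)
        * (Real.cos (3 * w.arg) : ℂ))
      + (-(3 / 2) * g * (Real.sin (3 * w.arg) : ℂ) * (Complex.I * (starRingEnd ℂ) w⁻¹)) := by
    rw [dbar, hx, hy, ← hconj]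
    simp only [Complex.one_re, Complex.I_re, mul_one, mul_zero]
    push_cast
    ring
  rw [key]
  refine (norm_add_le _ _).trans (add_le_add ?_ ?_)
  · rw [norm_neg, norm_mul, norm_mul, norm_mul, Complex.norm_real, Complex.norm_real]
    have : ‖Real.cos (3 * w.arg)‖ ≤ 1 := Real.abs_cos_le_one _
    rw [Real.norm_of_nonneg hc0]
    norm_num at this ⊢
    exact mul_le_of_le_one_right (by positivity) this
  · rw [norm_mul, norm_mul, norm_mul, norm_mul, Complex.norm_real, RCLike.norm_conj, norm_inv]
    have : ‖Real.sin (3 * w.arg)‖ ≤ 1 := Real.abs_sin_le_one _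
    rw [Complex.norm_I, one_mul, norm_neg]
    norm_num at this ⊢
    refine mul_le_mul_of_nonneg_right ?_ (by positivity)
    exact mul_le_of_le_one_right (by positivity) this

/-- Properties of the extension `R₁` on the open sector
`S = {z₀ + ρe^{iφ} : ρ > 0, 0 < φ < π/6}`: real differentiability, the prescribed boundary
values on the real axis (`φ → 0`) and on the ray `arg(z − z₀) = π/6`, and the Dbar estimate
`|∂̄R₁(z)| ≤ (1/2)(20t)^{−1/5}|r'((20t)^{−1/5}Re z)| + (3/2)‖r'‖_{L²}(20t)^{−1/10}|z−z₀|^{−1/2}`. -/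
theorem R1ext_properties (r : ℝ → ℂ) (hr : ContDiff ℝ 1 r)
    (hr' : MemLp (deriv r) 2 volume) (t k₀ : ℝ) (ht : 0 < t) (hk₀ : 0 ≤ k₀)
    (z₀ : ℝ) (hz₀ : z₀ = (20 * t) ^ ((1 : ℝ) / 5) * k₀) (S : Set ℂ)
    (hS : S = {z : ℂ | ∃ ρ φ : ℝ, 0 < ρ ∧ 0 < φ ∧ φ < Real.pi / 6 ∧
      z = (z₀ : ℂ) + (ρ : ℂ) * Complex.exp ((φ : ℂ) * Complex.I)}) :
    DifferentiableOn ℝ (R1ext r t k₀) S ∧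
    (∀ x : ℝ, z₀ < x → R1ext r t k₀ (x : ℂ) = -r ((20 * t) ^ (-(1 : ℝ) / 5) * x)) ∧
    (∀ ρ : ℝ, 0 < ρ →
      R1ext r t k₀ ((z₀ : ℂ) + (ρ : ℂ) * Complex.exp (((Real.pi / 6 : ℝ) : ℂ) * Complex.I))
        = -r k₀) ∧
    (∀ z ∈ S, ‖dbar (R1ext r t k₀) z‖
        ≤ (1 / 2) * (20 * t) ^ (-(1 : ℝ) / 5)
            * ‖deriv r ((20 * t) ^ (-(1 : ℝ) / 5) * z.re)‖
          + (3 / 2) * (eLpNorm (deriv r) 2 volume).toReal * (20 * t) ^ (-(1 : ℝ) / 10)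
            * ‖z - (z₀ : ℂ)‖ ^ (-(1 : ℝ) / 2)) := by
  have hpi := Real.pi_pos
  have harg : ∀ ρ φ : ℝ, 0 < ρ → 0 < φ → φ ≤ Real.pi / 6 →
      Complex.arg ((ρ : ℂ) * Complex.exp ((φ : ℂ) * Complex.I)) = φ := by
    intro ρ φ h1 h2 h3
    rw [Complex.exp_mul_I]
    exact Complex.arg_mul_cos_add_sin_mul_I h1 ⟨by linarith, by linarith⟩
  have hslit : ∀ z ∈ S, z - (z₀ : ℂ) ∈ Complex.slitPlane := by
    intro z hz
    rw [hS] at hz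
    obtain ⟨ρ, φ, h1, h2, h3, rfl⟩ := hz
    rw [add_sub_cancel_left, Complex.mem_slitPlane_iff_arg, harg ρ φ h1 h2 h3.le]
    refine ⟨by linarith, ?_⟩
    exact mul_ne_zero (by exact_mod_cast h1.ne') (Complex.exp_ne_zero _)
  refine ⟨?_, ?_, ?_, ?_⟩
  · intro z hz
    exact (R1ext_diff r hr t k₀ z (hz₀ ▸ hslit z hz)).differentiableWithinAt
  · intro x hx
    simp only [R1ext]
    rw [← hz₀, ← Complex.ofReal_sub, Complex.arg_ofReal_of_nonneg (by linarith)]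
    simp only [mul_zero, Real.cos_zero, Complex.ofReal_one, mul_one, Complex.ofReal_re]
    ring
  · intro ρ hρ
    simp only [R1ext]
    rw [← hz₀, add_sub_cancel_left, harg ρ _ hρ (by positivity) le_rfl,
      show 3 * (Real.pi / 6) = Real.pi / 2 by ring, Real.cos_pi_div_two]
    simp
  · intro z hz
    have hs := hslit z hz
    have hb := R1ext_dbar_bound r hr t k₀ ht z (z - (z₀ : ℂ)) (by rw [hz₀]) hs
    refine hb.trans ?_
    refine add_le_add le_rfl ?_
    have hpos : 0 < 20 * t := by positivity
    have hwpos : 0 < ‖z - (z₀ : ℂ)‖ := norm_pos_iff.mpr (Complex.slitPlane_ne_zero hs)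
    set c : ℝ := (20 * t) ^ (-(1 : ℝ) / 5) with hc
    have hcpos : 0 < c := by positivity
    have hk : k₀ = c * z₀ := by
      rw [hz₀, hc, ← mul_assoc, ← Real.rpow_add hpos]
      norm_num
    have h1 := holder_half r hr hr' (c * z.re) k₀
    have h2 : |k₀ - c * z.re| ≤ c * ‖z - (z₀ : ℂ)‖ := by
      have h3 : k₀ - c * z.re = -(c * (z - (z₀ : ℂ)).re) := by
        rw [Complex.sub_re, Complex.ofReal_re]
        linear_combination hk
      rw [h3, abs_neg, abs_mul, abs_of_pos hcpos]
      gcongr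
      exact Complex.abs_re_le_norm _
    have h4 : |k₀ - c * z.re| ^ ((1 : ℝ) / 2)
        ≤ (20 * t) ^ (-(1 : ℝ) / 10) * ‖z - (z₀ : ℂ)‖ ^ ((1 : ℝ) / 2) := by
      refine (Real.rpow_le_rpow (abs_nonneg _) h2 (by norm_num)).trans (le_of_eq ?_)
      rw [Real.mul_rpow hcpos.le hwpos.le, hc, ← Real.rpow_mul hpos.le]
      norm_num
    have h5 : ‖z - (z₀ : ℂ)‖ ^ ((1 : ℝ) / 2) * ‖z - (z₀ : ℂ)‖⁻¹
        = ‖z - (z₀ : ℂ)‖ ^ (-(1 : ℝ) / 2) := by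
      rw [← Real.rpow_neg_one, ← Real.rpow_add hwpos]
      norm_num
    rw [← h5]
    have h6 := h1.trans (mul_le_mul_of_nonneg_left h4 ENNReal.toReal_nonneg)
    have h7 := mul_le_mul_of_nonneg_right h6 (inv_nonneg.mpr hwpos.le)
    linarith
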